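/- Correctness of constrained inference for CCω: if ⊢ Γ and either Γ ⊢ t ▹_□ T or Γ ⊢ t ▹_Π T, then Γ ⊢ t : T. -/

import Mathlib

/-! Formalization of CCω (terms, reduction, conversion, undirected and
bidirectional typing, cumulativity) using de Bruijn indices, following
Lennon-Bertrand, "Complete Bidirectional Typing for the Calculus of
Inductive Constructions". -/

namespace CComega

/-- Terms of CCω: `t ::= x | □_i | Πx:t.t | λx:t.t | t t`,
with variables as de Bruijn indices. -/
inductive Tm : Type
  | var : ℕ → Tm
  | sort : ℕ → Tm
  | pi : Tm → Tm → Tm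
  | lam : Tm → Tm → Tm
  | app : Tm → Tm → Tm
deriving DecidableEq

/-- `lift n k t` shifts by `n` the de Bruijn indices of `t` that are ≥ `k`. -/
def lift (n k : ℕ) : Tm → Tm
  | .var i => if i < k then .var i else .var (i + n)
  | .sort i => .sort i
  | .pi A B => .pi (lift n k A) (lift n (k + 1) B)
  | .lam A t => .lam (lift n k A) (lift n (k + 1) t)
  | .app t u => .app (lift n k t) (lift n k u)

/-- `subst u k t` is the capture-avoiding substitution `t[u/k]` of `u`
for de Bruijn index `k` in `t`. -/
def subst (u : Tm) (k : ℕ) : Tm → Tm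
  | .var i => if i < k then .var i else if i = k then lift k 0 u else .var (i - 1)
  | .sort i => .sort i
  | .pi A B => .pi (subst u k A) (subst u (k + 1) B)
  | .lam A t => .lam (subst u k A) (subst u (k + 1) t)
  | .app t v => .app (subst u k t) (subst u k v)

/-- One-step reduction `t → t'`: the least congruence such that
`(λx:A.t) u → t[u/x]`. -/
inductive Red : Tm → Tm → Prop
  | beta (A t u : Tm) : Red (.app (.lam A t) u) (subst u 0 t)
  | piDom {A A'} (B : Tm) : Red A A' → Red (.pi A B) (.pi A' B)
  | piCod (A : Tm) {B B'} : Red B B' → Red (.pi A B) (.pi A B')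
  | lamDom {A A'} (t : Tm) : Red A A' → Red (.lam A t) (.lam A' t)
  | lamBody (A : Tm) {t t'} : Red t t' → Red (.lam A t) (.lam A t')
  | appFun {t t'} (u : Tm) : Red t t' → Red (.app t u) (.app t' u)
  | appArg (t : Tm) {u u'} : Red u u' → Red (.app t u) (.app t u')

/-- Multi-step reduction `t ↠ t'`: reflexive-transitive closure of `→`. -/
def Reds : Tm → Tm → Prop := Relation.ReflTransGen Red

/-- Conversion `t ≡ u`: symmetric, reflexive, transitive closure of `→`. -/
def Conv : Tm → Tm → Prop := Relation.EqvGen Red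

/-- Contexts are lists of (de Bruijn) declarations, most recent first. -/
abbrev Ctx := List Tm

mutual
/-- Context well-formedness `⊢ Γ`. -/
inductive WfCtx : Ctx → Prop
  | nil : WfCtx []
  | cons {Γ A i} : WfCtx Γ → Typed Γ A (.sort i) → WfCtx (A :: Γ)

/-- Undirected typing `Γ ⊢ t : T`. -/
inductive Typed : Ctx → Tm → Tm → Prop
  | sort {Γ i} : WfCtx Γ → Typed Γ (.sort i) (.sort (i + 1))
  | var {Γ n A} : WfCtx Γ → Γ[n]? = some A → Typed Γ (.var n) (lift (n + 1) 0 A)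
  | pi {Γ A B i j} : Typed Γ A (.sort i) → Typed (A :: Γ) B (.sort j) →
      Typed Γ (.pi A B) (.sort (max i j))
  | lam {Γ A B t i} : Typed Γ (.pi A B) (.sort i) → Typed (A :: Γ) t B →
      Typed Γ (.lam A t) (.pi A B)
  | app {Γ t u A B} : Typed Γ t (.pi A B) → Typed Γ u A →
      Typed Γ (.app t u) (subst u 0 B)
  | conv {Γ t A B i} : Typed Γ t A → Typed Γ B (.sort i) → Conv A B →
      Typed Γ t B
end

mutual
/-- Bidirectional inference `Γ ⊢ t ▹ T`. -/
inductive Infer : Ctx → Tm → Tm → Prop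
  | sort {Γ i} : Infer Γ (.sort i) (.sort (i + 1))
  | var {Γ n A} : Γ[n]? = some A → Infer Γ (.var n) (lift (n + 1) 0 A)
  | pi {Γ A B i j} : InferSort Γ A (.sort i) → InferSort (A :: Γ) B (.sort j) →
      Infer Γ (.pi A B) (.sort (max i j))
  | lam {Γ A t B i} : InferSort Γ A (.sort i) → Infer (A :: Γ) t B →
      Infer Γ (.lam A t) (.pi A B)
  | app {Γ t u A B} : InferPi Γ t (.pi A B) → Check Γ u A →
      Infer Γ (.app t u) (subst u 0 B)

/-- Bidirectional checking `Γ ⊢ t ◃ T`. -/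
inductive Check : Ctx → Tm → Tm → Prop
  | check {Γ t T T'} : Infer Γ t T' → Conv T' T → Check Γ t T

/-- Constrained inference `Γ ⊢ t ▹_□ T` (the output is a universe). -/
inductive InferSort : Ctx → Tm → Tm → Prop
  | inferSort {Γ t T i} : Infer Γ t T → Reds T (.sort i) → InferSort Γ t (.sort i)

/-- Constrained inference `Γ ⊢ t ▹_Π T` (the output is a product type). -/
inductive InferPi : Ctx → Tm → Tm → Prop
  | inferPi {Γ t T A B} : Infer Γ t T → Reds T (.pi A B) → InferPi Γ t (.pi A B)
end

/-- Weak-head reduction `t ⇝ t'`: reduction only at the head. -/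
inductive WhRed : Tm → Tm → Prop
  | beta (A t u : Tm) : WhRed (.app (.lam A t) u) (subst u 0 t)
  | appFun {t t'} (u : Tm) : WhRed t t' → WhRed (.app t u) (.app t' u)

/-- Multi-step weak-head reduction `t ⇝* t'`. -/
def WhReds : Tm → Tm → Prop := Relation.ReflTransGen WhRed

mutual
/-- Weak-head bidirectional inference: as `Infer`, but constrained inference
uses weak-head reduction. -/
inductive InferW : Ctx → Tm → Tm → Prop
  | sort {Γ i} : InferW Γ (.sort i) (.sort (i + 1))
  | var {Γ n A} : Γ[n]? = some A → InferW Γ (.var n) (lift (n + 1) 0 A)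
  | pi {Γ A B i j} : InferSortW Γ A (.sort i) → InferSortW (A :: Γ) B (.sort j) →
      InferW Γ (.pi A B) (.sort (max i j))
  | lam {Γ A t B i} : InferSortW Γ A (.sort i) → InferW (A :: Γ) t B →
      InferW Γ (.lam A t) (.pi A B)
  | app {Γ t u A B} : InferPiW Γ t (.pi A B) → CheckW Γ u A →
      InferW Γ (.app t u) (subst u 0 B)

/-- Weak-head bidirectional checking. -/
inductive CheckW : Ctx → Tm → Tm → Prop
  | check {Γ t T T'} : InferW Γ t T' → Conv T' T → CheckW Γ t T

/-- Weak-head constrained inference `Γ ⊢ t ▹_□ T`. -/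
inductive InferSortW : Ctx → Tm → Tm → Prop
  | inferSort {Γ t T i} : InferW Γ t T → WhReds T (.sort i) →
      InferSortW Γ t (.sort i)

/-- Weak-head constrained inference `Γ ⊢ t ▹_Π T`. -/
inductive InferPiW : Ctx → Tm → Tm → Prop
  | inferPi {Γ t T A B} : InferW Γ t T → WhReds T (.pi A B) →
      InferPiW Γ t (.pi A B)
end

/-- Cumulativity `t ≼ u`: the least transitive relation containing conversion
such that `□_i ≼ □_j` whenever `i ≤ j` and `Πx:A.B ≼ Πx:A'.B'` whenever
`A ≡ A'` and `B ≼ B'`. -/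
inductive Cum : Tm → Tm → Prop
  | ofConv {t u} : Conv t u → Cum t u
  | sort {i j : ℕ} : i ≤ j → Cum (.sort i) (.sort j)
  | pi {A A' B B'} : Conv A A' → Cum B B' → Cum (.pi A B) (.pi A' B')
  | trans {t u v} : Cum t u → Cum u v → Cum t v

mutual
/-- Context well-formedness for the cumulative undirected system. -/
inductive WfCtxC : Ctx → Prop
  | nil : WfCtxC []
  | cons {Γ A i} : WfCtxC Γ → TypedC Γ A (.sort i) → WfCtxC (A :: Γ)

/-- Cumulative undirected typing `Γ ⊢ t : T`: as `Typed`, with the conversion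
rule replaced by cumulativity. -/
inductive TypedC : Ctx → Tm → Tm → Prop
  | sort {Γ i} : WfCtxC Γ → TypedC Γ (.sort i) (.sort (i + 1))
  | var {Γ n A} : WfCtxC Γ → Γ[n]? = some A → TypedC Γ (.var n) (lift (n + 1) 0 A)
  | pi {Γ A B i j} : TypedC Γ A (.sort i) → TypedC (A :: Γ) B (.sort j) →
      TypedC Γ (.pi A B) (.sort (max i j))
  | lam {Γ A B t i} : TypedC Γ (.pi A B) (.sort i) → TypedC (A :: Γ) t B →
      TypedC Γ (.lam A t) (.pi A B)
  | app {Γ t u A B} : TypedC Γ t (.pi A B) → TypedC Γ u A →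
      TypedC Γ (.app t u) (subst u 0 B)
  | cumul {Γ t A B i} : TypedC Γ t A → TypedC Γ B (.sort i) → Cum A B →
      TypedC Γ t B
end

mutual
/-- Cumulative bidirectional inference `Γ ⊢ t ▹ T`. -/
inductive InferC : Ctx → Tm → Tm → Prop
  | sort {Γ i} : InferC Γ (.sort i) (.sort (i + 1))
  | var {Γ n A} : Γ[n]? = some A → InferC Γ (.var n) (lift (n + 1) 0 A)
  | pi {Γ A B i j} : InferSortC Γ A (.sort i) → InferSortC (A :: Γ) B (.sort j) →
      InferC Γ (.pi A B) (.sort (max i j))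
  | lam {Γ A t B i} : InferSortC Γ A (.sort i) → InferC (A :: Γ) t B →
      InferC Γ (.lam A t) (.pi A B)
  | app {Γ t u A B} : InferPiC Γ t (.pi A B) → CheckC Γ u A →
      InferC Γ (.app t u) (subst u 0 B)

/-- Cumulative bidirectional checking `Γ ⊢ t ◃ T`, using cumulativity. -/
inductive CheckC : Ctx → Tm → Tm → Prop
  | check {Γ t T T'} : InferC Γ t T' → Cum T' T → CheckC Γ t T

/-- Cumulative constrained inference `Γ ⊢ t ▹_□ T` (unchanged: uses reduction). -/
inductive InferSortC : Ctx → Tm → Tm → Prop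
  | inferSort {Γ t T i} : InferC Γ t T → Reds T (.sort i) → InferSortC Γ t (.sort i)

/-- Cumulative constrained inference `Γ ⊢ t ▹_Π T` (unchanged: uses reduction). -/
inductive InferPiC : Ctx → Tm → Tm → Prop
  | inferPi {Γ t T A B} : InferC Γ t T → Reds T (.pi A B) → InferPiC Γ t (.pi A B)
end

/-! ### Commutation of lifting and substitution -/

theorem lift_zero (t : Tm) (k : ℕ) : lift 0 k t = t := by
  induction t generalizing k <;> simp_all [lift]

theorem lift_lift_of_between (t : Tm) {n k p i : ℕ} (h₁ : k ≤ i) (h₂ : i ≤ k + n) :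
    lift p i (lift n k t) = lift (p + n) k t := by
  induction t generalizing k i with
  | var m => grind [lift]
  | sort => rfl
  | pi A B ihA ihB => simp only [lift]; rw [ihA h₁ h₂, ihB (by omega) (by omega)]
  | lam A B ihA ihB => simp only [lift]; rw [ihA h₁ h₂, ihB (by omega) (by omega)]
  | app A B ihA ihB => simp only [lift]; rw [ihA h₁ h₂, ihB h₁ h₂]

theorem lift_lift_comm (t : Tm) {n k p i : ℕ} (h : i ≤ k) :
    lift p i (lift n k t) = lift n (p + k) (lift p i t) := by
  induction t generalizing k i with
  | var m => grind [lift]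
  | sort => rfl
  | pi A B ihA ihB => simp only [lift]; rw [ihA h, ihB (by omega)]; rfl
  | lam A B ihA ihB => simp only [lift]; rw [ihA h, ihB (by omega)]; rfl
  | app A B ihA ihB => simp only [lift]; rw [ihA h, ihB h]

theorem subst_lift_cancel (u t : Tm) {n k p : ℕ} (h₁ : k ≤ p) (h₂ : p ≤ n + k) :
    subst u p (lift (n + 1) k t) = lift n k t := by
  induction t generalizing k p with
  | var m => grind [lift, subst]
  | sort => rfl
  | pi A B ihA ihB => simp only [lift, subst]; rw [ihA h₁ h₂, ihB (by omega) (by omega)]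
  | lam A B ihA ihB => simp only [lift, subst]; rw [ihA h₁ h₂, ihB (by omega) (by omega)]
  | app A B ihA ihB => simp only [lift, subst]; rw [ihA h₁ h₂, ihB h₁ h₂]

theorem lift_subst_of_le (u t : Tm) {n k p : ℕ} (h : k ≤ p) :
    lift n k (subst u p t) = subst u (n + p) (lift n k t) := by
  induction t generalizing k p with
  | var m =>
    have := lift_lift_of_between u (n := p) (k := 0) (p := n) (i := k) (by omega) (by omega)
    grind [lift, subst]
  | sort => rfl
  | pi A B ihA ihB => simp only [lift, subst]; rw [ihA h, ihB (by omega)]; rfl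
  | lam A B ihA ihB => simp only [lift, subst]; rw [ihA h, ihB (by omega)]; rfl
  | app A B ihA ihB => simp only [lift, subst]; rw [ihA h, ihB h]

theorem lift_subst_distrib (u t : Tm) (n k p : ℕ) :
    lift n (p + k) (subst u p t) = subst (lift n k u) p (lift n (p + k + 1) t) := by
  induction t generalizing p with
  | var m =>
    have := lift_lift_comm u (n := n) (k := k) (p := p) (i := 0) (by omega)
    grind [lift, subst]
  | sort => rfl
  | pi A B ihA ihB =>
    have := ihB (p + 1)
    rw [Nat.add_right_comm p 1 k] at this
    simp only [lift, subst, ihA, this]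
  | lam A B ihA ihB =>
    have := ihB (p + 1)
    rw [Nat.add_right_comm p 1 k] at this
    simp only [lift, subst, ihA, this]
  | app A B ihA ihB => simp only [lift, subst, ihA, ihB]

theorem subst_subst_distrib (v u t : Tm) (n p : ℕ) :
    subst v (p + n) (subst u p t) = subst (subst v n u) p (subst v (p + n + 1) t) := by
  induction t generalizing p with
  | var m =>
    have h₁ := lift_subst_of_le v u (n := p) (k := 0) (p := n) (by omega)
    have h₂ := subst_lift_cancel (subst v n u) v (n := p + n) (k := 0) (p := p)
      (by omega) (by omega)
    grind [lift, subst]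
  | sort => rfl
  | pi A B ihA ihB =>
    have := ihB (p + 1)
    rw [Nat.add_right_comm p 1 n] at this
    simp only [subst, ihA, this]
  | lam A B ihA ihB =>
    have := ihB (p + 1)
    rw [Nat.add_right_comm p 1 n] at this
    simp only [subst, ihA, this]
  | app A B ihA ihB => simp only [subst, ihA, ihB]

/-! ### Parallel reduction and confluence -/

/-- Parallel reduction. -/
inductive Par : Tm → Tm → Prop
  | var (i : ℕ) : Par (.var i) (.var i)
  | sort (i : ℕ) : Par (.sort i) (.sort i)
  | pi {A A' B B'} : Par A A' → Par B B' → Par (.pi A B) (.pi A' B')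
  | lam {A A' t t'} : Par A A' → Par t t' → Par (.lam A t) (.lam A' t')
  | app {t t' u u'} : Par t t' → Par u u' → Par (.app t u) (.app t' u')
  | beta (A : Tm) {t t' u u'} : Par t t' → Par u u' →
      Par (.app (.lam A t) u) (subst u' 0 t')

theorem Par.refl (t : Tm) : Par t t := by
  induction t <;> constructor <;> assumption

theorem Red.par {t t' : Tm} (h : Red t t') : Par t t' := by
  induction h with
  | beta => exact .beta _ (.refl _) (.refl _)
  | piDom _ _ ih => exact .pi ih (.refl _)
  | piCod _ _ ih => exact .pi (.refl _) ih
  | lamDom _ _ ih => exact .lam ih (.refl _)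
  | lamBody _ _ ih => exact .lam (.refl _) ih
  | appFun _ _ ih => exact .app ih (.refl _)
  | appArg _ _ ih => exact .app (.refl _) ih

theorem Reds.map {f : Tm → Tm} (hf : ∀ {t u}, Red t u → Red (f t) (f u)) {t u : Tm}
    (h : Reds t u) : Reds (f t) (f u) := by
  induction h with
  | refl => exact .refl
  | tail _ h ih => exact Relation.ReflTransGen.tail ih (hf h)

theorem Reds.trans {t u v : Tm} (h₁ : Reds t u) (h₂ : Reds u v) : Reds t v :=
  Relation.ReflTransGen.trans h₁ h₂

theorem Reds.pi {A A' B B' : Tm} (hA : Reds A A') (hB : Reds B B') :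
    Reds (.pi A B) (.pi A' B') :=
  (hA.map (f := (Tm.pi · B)) (.piDom B)).trans (hB.map (f := Tm.pi A') (.piCod A'))

theorem Reds.lam {A A' t t' : Tm} (hA : Reds A A') (ht : Reds t t') :
    Reds (.lam A t) (.lam A' t') :=
  (hA.map (f := (Tm.lam · t)) (.lamDom t)).trans (ht.map (f := Tm.lam A') (.lamBody A'))

theorem Reds.app {t t' u u' : Tm} (ht : Reds t t') (hu : Reds u u') :
    Reds (.app t u) (.app t' u') :=
  (ht.map (f := (Tm.app · u)) (.appFun u)).trans (hu.map (f := Tm.app t') (.appArg t'))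

theorem Par.reds {t t' : Tm} (h : Par t t') : Reds t t' := by
  induction h with
  | var => exact .refl
  | sort => exact .refl
  | pi _ _ ihA ihB => exact ihA.pi ihB
  | lam _ _ ihA iht => exact ihA.lam iht
  | app _ _ iht ihu => exact iht.app ihu
  | beta A _ _ iht ihu =>
    exact Relation.ReflTransGen.tail (Reds.app (Reds.lam .refl iht) ihu) (.beta A _ _)

theorem Par.lift {t t' : Tm} (h : Par t t') (n k : ℕ) :
    Par (lift n k t) (lift n k t') := by
  induction h generalizing k with
  | var => exact .refl _
  | sort => exact .refl _
  | pi _ _ ihA ihB => exact .pi (ihA k) (ihB (k + 1))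
  | lam _ _ ihA iht => exact .lam (ihA k) (iht (k + 1))
  | app _ _ iht ihu => exact .app (iht k) (ihu k)
  | @beta A t t' u u' _ _ iht ihu =>
    have := lift_subst_distrib u' t' n k 0
    rw [Nat.zero_add] at this
    rw [this]
    exact .beta _ (iht (k + 1)) (ihu k)

theorem Par.subst {t t' u u' : Tm} (h : Par t t') (hu : Par u u') (k : ℕ) :
    Par (subst u k t) (subst u' k t') := by
  induction h generalizing k with
  | var i =>
    simp only [CComega.subst]
    split_ifs
    · exact .refl _
    · exact hu.lift k 0
    · exact .refl _
  | sort => exact .refl _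
  | pi _ _ ihA ihB => exact .pi (ihA k) (ihB (k + 1))
  | lam _ _ ihA iht => exact .lam (ihA k) (iht (k + 1))
  | app _ _ iht ihu => exact .app (iht k) (ihu k)
  | @beta A t t' v v' _ _ iht ihv =>
    have := subst_subst_distrib u' v' t' k 0
    rw [Nat.zero_add] at this
    rw [this]
    exact .beta _ (iht (k + 1)) (ihv k)

theorem Par.diamond {a b c : Tm} (hb : Par a b) (hc : Par a c) :
    ∃ d, Par b d ∧ Par c d := by
  induction hb generalizing c with
  | var => exact ⟨c, hc, .refl _⟩
  | sort => exact ⟨c, hc, .refl _⟩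
  | pi _ _ ihA ihB =>
    cases hc with
    | pi hA hB =>
      obtain ⟨A, hA₁, hA₂⟩ := ihA hA
      obtain ⟨B, hB₁, hB₂⟩ := ihB hB
      exact ⟨_, .pi hA₁ hB₁, .pi hA₂ hB₂⟩
  | lam _ _ ihA ihB =>
    cases hc with
    | lam hA hB =>
      obtain ⟨A, hA₁, hA₂⟩ := ihA hA
      obtain ⟨B, hB₁, hB₂⟩ := ihB hB
      exact ⟨_, .lam hA₁ hB₁, .lam hA₂ hB₂⟩
  | app ht _ iht ihu =>
    cases hc with
    | app ht' hu' =>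
      obtain ⟨t, ht₁, ht₂⟩ := iht ht'
      obtain ⟨u, hu₁, hu₂⟩ := ihu hu'
      exact ⟨_, .app ht₁ hu₁, .app ht₂ hu₂⟩
    | beta A ht' hu' =>
      obtain ⟨u, hu₁, hu₂⟩ := ihu hu'
      cases ht with
      | lam hA ht =>
        obtain ⟨t, ht₁, ht₂⟩ := iht (.lam hA ht')
        cases ht₁ with
        | lam _ ht₁ =>
          cases ht₂ with
          | lam _ ht₂ => exact ⟨_, .beta _ ht₁ hu₁, ht₂.subst hu₂ 0⟩
  | beta A _ _ iht ihu =>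
    cases hc with
    | app ht' hu' =>
      obtain ⟨u, hu₁, hu₂⟩ := ihu hu'
      cases ht' with
      | lam _ ht' =>
        obtain ⟨t, ht₁, ht₂⟩ := iht ht'
        exact ⟨_, ht₁.subst hu₁ 0, .beta _ ht₂ hu₂⟩
    | beta _ ht' hu' =>
      obtain ⟨t, ht₁, ht₂⟩ := iht ht'
      obtain ⟨u, hu₁, hu₂⟩ := ihu hu'
      exact ⟨_, ht₁.subst hu₁ 0, ht₂.subst hu₂ 0⟩

theorem reds_iff_reflTransGen_par {t t' : Tm} :
    Reds t t' ↔ Relation.ReflTransGen Par t t' := by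
  constructor
  · intro h
    induction h with
    | refl => exact .refl
    | tail _ h ih => exact .tail ih h.par
  · intro h
    induction h with
    | refl => exact .refl
    | tail _ h ih => exact ih.trans h.reds

theorem Reds.confluent {a b c : Tm} (hb : Reds a b) (hc : Reds a c) :
    ∃ d, Reds b d ∧ Reds c d := by
  rw [reds_iff_reflTransGen_par] at hb hc
  obtain ⟨d, h₁, h₂⟩ := Relation.church_rosser (r := Par) (fun _ _ _ h₁ h₂ =>
    let ⟨d, h₁', h₂'⟩ := h₁.diamond h₂
    ⟨d, .single h₁', .single h₂'⟩) hb hc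
  exact ⟨d, reds_iff_reflTransGen_par.2 h₁, reds_iff_reflTransGen_par.2 h₂⟩

/-! ### Conversion -/

theorem Conv.refl (t : Tm) : Conv t t := Relation.EqvGen.refl t

theorem Conv.symm {t u : Tm} (h : Conv t u) : Conv u t := Relation.EqvGen.symm _ _ h

theorem Conv.trans {t u v : Tm} (h₁ : Conv t u) (h₂ : Conv u v) : Conv t v :=
  Relation.EqvGen.trans _ _ _ h₁ h₂

theorem Reds.conv {t u : Tm} (h : Reds t u) : Conv t u := by
  induction h with
  | refl => exact .refl _
  | tail _ h ih => exact ih.trans (.rel _ _ h)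

theorem Conv.map {f : Tm → Tm} (hf : ∀ t u, Red t u → Conv (f t) (f u)) {t u : Tm}
    (h : Conv t u) : Conv (f t) (f u) := by
  induction h with
  | rel _ _ h => exact hf _ _ h
  | refl => exact .refl _
  | symm _ _ _ ih => exact ih.symm
  | trans _ _ _ _ _ ih₁ ih₂ => exact ih₁.trans ih₂

theorem Conv.lift {t u : Tm} (h : Conv t u) (n k : ℕ) : Conv (lift n k t) (lift n k u) :=
  Conv.map (fun _ _ h => (h.par.lift n k).reds.conv) h

theorem Conv.subst {t t' : Tm} (h : Conv t t') (u : Tm) (k : ℕ) :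
    Conv (subst u k t) (subst u k t') :=
  Conv.map (fun _ _ h => (h.par.subst (.refl u) k).reds.conv) h

theorem Conv.exists_common_reduct {t u : Tm} (h : Conv t u) :
    ∃ v, Reds t v ∧ Reds u v := by
  induction h with
  | rel _ u h => exact ⟨u, .single h, .refl⟩
  | refl t => exact ⟨t, .refl, .refl⟩
  | symm _ _ _ ih => obtain ⟨v, h₁, h₂⟩ := ih; exact ⟨v, h₂, h₁⟩
  | trans _ _ _ _ _ ih₁ ih₂ =>
    obtain ⟨v, h₁, h₂⟩ := ih₁
    obtain ⟨w, h₃, h₄⟩ := ih₂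
    obtain ⟨x, h₅, h₆⟩ := h₂.confluent h₃
    exact ⟨x, h₁.trans h₅, h₄.trans h₆⟩

theorem Reds.pi_inv {A B T : Tm} (h : Reds (.pi A B) T) :
    ∃ A' B', T = .pi A' B' ∧ Reds A A' ∧ Reds B B' := by
  induction h with
  | refl => exact ⟨A, B, rfl, .refl, .refl⟩
  | tail _ h ih =>
    obtain ⟨A', B', rfl, hA, hB⟩ := ih
    cases h with
    | piDom _ h => exact ⟨_, _, rfl, Relation.ReflTransGen.tail hA h, hB⟩
    | piCod _ h => exact ⟨_, _, rfl, hA, Relation.ReflTransGen.tail hB h⟩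

theorem Conv.pi_inj {A A' B B' : Tm} (h : Conv (.pi A B) (.pi A' B')) :
    Conv A A' ∧ Conv B B' := by
  obtain ⟨v, h₁, h₂⟩ := h.exists_common_reduct
  obtain ⟨C, D, rfl, hA, hB⟩ := h₁.pi_inv
  obtain ⟨_, _, h, hA', hB'⟩ := h₂.pi_inv
  cases h
  exact ⟨hA.conv.trans hA'.conv.symm, hB.conv.trans hB'.conv.symm⟩

/-! ### Metatheory of undirected typing -/

/-- Induction on typing derivations, ignoring the well-formedness derivations inside. -/
theorem Typed.ind {motive : ∀ {Γ t T}, Typed Γ t T → Prop}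
    (sort : ∀ {Γ i} (hw : WfCtx Γ), motive (Typed.sort (i := i) hw))
    (var : ∀ {Γ n A} (hw : WfCtx Γ) (hn : Γ[n]? = some A), motive (Typed.var hw hn))
    (pi : ∀ {Γ A B i j} (hA : Typed Γ A (.sort i)) (hB : Typed (A :: Γ) B (.sort j)),
      motive hA → motive hB → motive (Typed.pi hA hB))
    (lam : ∀ {Γ A B t i} (hP : Typed Γ (.pi A B) (.sort i)) (ht : Typed (A :: Γ) t B),
      motive hP → motive ht → motive (Typed.lam hP ht))
    (app : ∀ {Γ t u A B} (ht : Typed Γ t (.pi A B)) (hu : Typed Γ u A),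
      motive ht → motive hu → motive (Typed.app ht hu))
    (conv : ∀ {Γ t A B i} (ht : Typed Γ t A) (hB : Typed Γ B (.sort i)) (hc : Conv A B),
      motive ht → motive hB → motive (Typed.conv ht hB hc))
    {Γ t T} (h : Typed Γ t T) : motive h :=
  Typed.rec (motive_1 := fun _ _ => True) (motive_2 := fun _ _ _ h => motive h)
    trivial (fun _ _ _ _ => trivial) (fun h _ => sort h) (fun h hn _ => var h hn)
    pi lam app conv h

theorem Typed.wf {Γ : Ctx} {t T : Tm} (h : Typed Γ t T) : WfCtx Γ := by
  induction h using Typed.ind with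
  | sort h => exact h
  | var h _ => exact h
  | pi _ _ ih _ => exact ih
  | lam _ _ ih _ => exact ih
  | app _ _ ih _ => exact ih
  | conv _ _ _ ih _ => exact ih

theorem Typed.pi_inv {Γ : Ctx} {A B T : Tm} (h : Typed Γ (.pi A B) T) :
    ∃ i j, Typed Γ A (.sort i) ∧ Typed (A :: Γ) B (.sort j) := by
  generalize ht : Tm.pi A B = t at h
  induction h using Typed.ind with
  | pi hA hB _ _ => cases ht; exact ⟨_, _, hA, hB⟩
  | conv _ _ _ ih _ => exact ih ht
  | sort | var | lam | app => cases ht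

theorem Typed.lam_inv {Γ : Ctx} {A t T : Tm} (h : Typed Γ (.lam A t) T) :
    ∃ B i, Typed Γ (.pi A B) (.sort i) ∧ Typed (A :: Γ) t B ∧ Conv (.pi A B) T := by
  generalize hs : Tm.lam A t = s at h
  induction h using Typed.ind with
  | lam hP ht _ _ => cases hs; exact ⟨_, _, hP, ht, .refl _⟩
  | conv _ _ hc ih _ =>
    obtain ⟨B, i, h₁, h₂, h₃⟩ := ih hs
    exact ⟨B, i, h₁, h₂, h₃.trans hc⟩
  | sort | var | pi | app => cases hs

/-- `Insert A n Γ Γ'`: `Γ'` is `Γ` with the declaration `A` inserted at position `n`. -/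
inductive Insert (A : Tm) : ℕ → Ctx → Ctx → Prop
  | here {Γ} : Insert A 0 Γ (A :: Γ)
  | there {n Γ Γ'} (B : Tm) : Insert A n Γ Γ' →
      Insert A (n + 1) (B :: Γ) (lift 1 n B :: Γ')

theorem Insert.getElem? {A B : Tm} {n m : ℕ} {Γ Γ' : Ctx} (h : Insert A n Γ Γ')
    (hm : Γ[m]? = some B) :
    (m < n ∧ ∃ B', Γ'[m]? = some B' ∧ lift (m + 1) 0 B' = lift 1 n (lift (m + 1) 0 B)) ∨
      (n ≤ m ∧ Γ'[m + 1]? = some B) := by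
  induction h generalizing m with
  | here => exact .inr ⟨m.zero_le, hm⟩
  | @there n Γ Γ' C h ih =>
    cases m with
    | zero =>
      simp only [List.getElem?_cons_zero, Option.some.injEq] at hm
      subst hm
      refine .inl ⟨by omega, _, rfl, ?_⟩
      rw [lift_lift_comm C (Nat.zero_le n), Nat.add_comm]
    | succ m =>
      rcases ih hm with ⟨hlt, B', hB', he⟩ | ⟨hle, hB⟩
      · refine .inl ⟨by omega, B', hB', ?_⟩
        have h₁ := lift_lift_of_between B' (n := m + 1) (k := 0) (p := 1) (i := 0)
          (by omega) (by omega)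
        have h₂ := lift_lift_of_between B (n := m + 1) (k := 0) (p := 1) (i := 0)
          (by omega) (by omega)
        rw [Nat.add_comm 1 (m + 1)] at h₁ h₂
        rw [← h₁, ← h₂, he, lift_lift_comm _ (Nat.zero_le n), Nat.add_comm 1 n]
      · exact .inr ⟨by omega, hB⟩

theorem Typed.insert {Γ : Ctx} {t T : Tm} (h : Typed Γ t T) {A : Tm} {n : ℕ} {Γ' : Ctx}
    (hi : Insert A n Γ Γ') (hw : WfCtx Γ') : Typed Γ' (lift 1 n t) (lift 1 n T) := by
  induction h using Typed.ind generalizing n Γ' with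
  | sort => exact .sort hw
  | @var Γ m B _ hm =>
    rcases hi.getElem? hm with ⟨hlt, B', hB', he⟩ | ⟨hle, hB⟩
    · rw [← he, CComega.lift, if_pos hlt]
      exact .var hw hB'
    · rw [CComega.lift, if_neg (by omega), lift_lift_of_between B (by omega) (by omega),
        Nat.add_comm 1]
      exact .var hw hB
  | pi _ _ ihA ihB =>
    have hA := ihA hi hw
    exact .pi hA (ihB (.there _ hi) (.cons hw hA))
  | lam _ _ ihP iht =>
    have hP := ihP hi hw
    obtain ⟨_, _, hA, _⟩ := hP.pi_inv
    exact .lam hP (iht (.there _ hi) (.cons hw hA))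
  | @app Γ t u A B _ _ iht ihu =>
    have := lift_subst_distrib u B 1 n 0
    rw [Nat.zero_add] at this
    rw [this]
    exact .app (iht hi hw) (ihu hi hw)
  | conv _ _ hc iht ihB => exact .conv (iht hi hw) (ihB hi hw) (hc.lift 1 n)

theorem Typed.weaken {Γ : Ctx} {t T A : Tm} (h : Typed Γ t T) (hw : WfCtx (A :: Γ)) :
    Typed (A :: Γ) (lift 1 0 t) (lift 1 0 T) :=
  h.insert .here hw

theorem lift_one_lift (t : Tm) (n : ℕ) : lift 1 0 (lift n 0 t) = lift (n + 1) 0 t := by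
  rw [lift_lift_of_between t (by omega) (by omega), Nat.add_comm]

theorem WfCtx.tail {Γ : Ctx} {A : Tm} (h : WfCtx (A :: Γ)) : WfCtx Γ := by
  cases h; assumption

/-- `SubstCtx u n Γ Γ'`: `Γ'` is `Γ` with the declaration at position `n`
instantiated by `u`. -/
inductive SubstCtx (u : Tm) : ℕ → Ctx → Ctx → Prop
  | here {Γ A} : Typed Γ u A → SubstCtx u 0 (A :: Γ) Γ
  | there {n Γ Γ'} (B : Tm) : SubstCtx u n Γ Γ' →
      SubstCtx u (n + 1) (B :: Γ) (subst u n B :: Γ')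

theorem SubstCtx.typed_var {u B : Tm} {n m : ℕ} {Γ Γ' : Ctx} (h : SubstCtx u n Γ Γ')
    (hw : WfCtx Γ') (hm : Γ[m]? = some B) :
    Typed Γ' (subst u n (.var m)) (subst u n (lift (m + 1) 0 B)) := by
  induction h generalizing m with
  | @here Γ A hu =>
    rw [subst_lift_cancel u B (Nat.zero_le 0) (by omega)]
    cases m with
    | zero =>
      simp only [List.getElem?_cons_zero, Option.some.injEq] at hm
      subst hm
      simpa [CComega.subst, lift_zero] using hu
    | succ m => exact .var hw hm
  | @there n Γ Γ' C h ih =>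
    cases m with
    | zero =>
      simp only [List.getElem?_cons_zero, Option.some.injEq] at hm
      subst hm
      rw [Nat.add_comm n 1, ← lift_subst_of_le u C (Nat.zero_le n)]
      simpa [CComega.subst] using Typed.var (n := 0) hw rfl
    | succ m =>
      have := (ih hw.tail hm).weaken hw
      rw [lift_subst_of_le _ _ (Nat.zero_le n), lift_subst_of_le _ _ (Nat.zero_le n),
        lift_one_lift, Nat.add_comm 1 n] at this
      exact this

theorem Typed.substCtx {Γ : Ctx} {t T : Tm} (h : Typed Γ t T) {u : Tm} {n : ℕ} {Γ' : Ctx}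
    (hs : SubstCtx u n Γ Γ') (hw : WfCtx Γ') : Typed Γ' (subst u n t) (subst u n T) := by
  induction h using Typed.ind generalizing n Γ' with
  | sort => exact .sort hw
  | var _ hm => exact hs.typed_var hw hm
  | pi _ _ ihA ihB =>
    have hA := ihA hs hw
    exact .pi hA (ihB (.there _ hs) (.cons hw hA))
  | lam _ _ ihP iht =>
    have hP := ihP hs hw
    obtain ⟨_, _, hA, _⟩ := hP.pi_inv
    exact .lam hP (iht (.there _ hs) (.cons hw hA))
  | @app Γ t v A B _ _ iht ihv =>
    have := subst_subst_distrib u v B n 0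
    rw [Nat.zero_add] at this
    rw [this]
    exact .app (iht hs hw) (ihv hs hw)
  | conv _ _ hc iht ihB => exact .conv (iht hs hw) (ihB hs hw) (hc.subst u n)

theorem Typed.subst {Γ : Ctx} {t T u A : Tm} (h : Typed (A :: Γ) t T) (hu : Typed Γ u A) :
    Typed Γ (subst u 0 t) (subst u 0 T) :=
  h.substCtx (.here hu) hu.wf

theorem WfCtx.typed_getElem? {Γ : Ctx} (hw : WfCtx Γ) {n : ℕ} {A : Tm}
    (hn : Γ[n]? = some A) : ∃ i, Typed Γ (lift (n + 1) 0 A) (.sort i) := by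
  induction Γ generalizing n with
  | nil => simp at hn
  | cons B Γ ih =>
    cases n with
    | zero =>
      simp only [List.getElem?_cons_zero, Option.some.injEq] at hn
      subst hn
      cases hw with
      | cons hΓ hB => exact ⟨_, hB.weaken (.cons hΓ hB)⟩
    | succ n =>
      obtain ⟨i, h⟩ := ih hw.tail hn
      exact ⟨i, lift_one_lift A (n + 1) ▸ h.weaken hw⟩

theorem Typed.validity {Γ : Ctx} {t T : Tm} (h : Typed Γ t T) :
    ∃ i, Typed Γ T (.sort i) := by
  induction h using Typed.ind with
  | sort hw => exact ⟨_, .sort hw⟩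
  | var hw hn => exact hw.typed_getElem? hn
  | pi hA _ _ _ => exact ⟨_, .sort hA.wf⟩
  | lam hP _ _ _ => exact ⟨_, hP⟩
  | app _ hu iht _ =>
    obtain ⟨_, hP⟩ := iht
    obtain ⟨_, j, _, hB⟩ := hP.pi_inv
    exact ⟨j, hB.subst hu⟩
  | conv _ hB _ _ _ => exact ⟨_, hB⟩

/-- `ConvCtx Γ Γ'`: `Γ'` is `Γ` with one well-formed declaration replaced
by a convertible one. -/
inductive ConvCtx : Ctx → Ctx → Prop
  | here {Γ A A' i} : Typed Γ A (.sort i) → Conv A' A → ConvCtx (A :: Γ) (A' :: Γ)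
  | there {Γ Γ'} (B : Tm) : ConvCtx Γ Γ' → ConvCtx (B :: Γ) (B :: Γ')

theorem ConvCtx.typed_var {Γ Γ' : Ctx} (h : ConvCtx Γ Γ') (hw : WfCtx Γ') {n : ℕ} {A : Tm}
    (hn : Γ[n]? = some A) : Typed Γ' (.var n) (lift (n + 1) 0 A) := by
  induction h generalizing n with
  | here hA hc =>
    cases n with
    | zero =>
      simp only [List.getElem?_cons_zero, Option.some.injEq] at hn
      subst hn
      exact .conv (.var hw rfl) (hA.weaken hw) (hc.lift 1 0)
    | succ n => exact .var hw hn
  | there B _ ih =>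
    cases n with
    | zero => exact .var hw hn
    | succ n =>
      have := (ih hw.tail hn).weaken hw
      rwa [lift_one_lift] at this

theorem Typed.convCtx {Γ : Ctx} {t T : Tm} (h : Typed Γ t T) {Γ' : Ctx}
    (hc : ConvCtx Γ Γ') (hw : WfCtx Γ') : Typed Γ' t T := by
  induction h using Typed.ind generalizing Γ' with
  | sort => exact .sort hw
  | var _ hm => exact hc.typed_var hw hm
  | pi _ _ ihA ihB =>
    have hA := ihA hc hw
    exact .pi hA (ihB (.there _ hc) (.cons hw hA))
  | lam _ _ ihP iht =>
    have hP := ihP hc hw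
    obtain ⟨_, _, hA, _⟩ := hP.pi_inv
    exact .lam hP (iht (.there _ hc) (.cons hw hA))
  | app _ _ iht ihu => exact .app (iht hc hw) (ihu hc hw)
  | conv _ _ h iht ihB => exact .conv (iht hc hw) (ihB hc hw) h

/-- Subject reduction. -/
theorem Typed.red {Γ : Ctx} {t t' T : Tm} (h : Typed Γ t T) (hr : Red t t') :
    Typed Γ t' T := by
  induction h using Typed.ind generalizing t' with
  | sort => cases hr
  | var => cases hr
  | pi hA hB ihA ihB =>
    cases hr with
    | piDom _ hr =>
      have hA' := ihA hr
      exact .pi hA' (hB.convCtx (.here hA (Conv.symm (.rel _ _ hr))) (.cons hA.wf hA'))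
    | piCod _ hr => exact .pi hA (ihB hr)
  | lam hP ht ihP iht =>
    cases hr with
    | lamDom _ hr =>
      have hP' := ihP (.piDom _ hr)
      obtain ⟨_, _, hA, _⟩ := hP.pi_inv
      obtain ⟨_, _, hA', _⟩ := hP'.pi_inv
      have hc := Conv.symm (.rel _ _ hr)
      exact .conv (.lam hP' (ht.convCtx (.here hA hc) (.cons hA.wf hA'))) hP
        (Conv.symm (.rel _ _ (.piDom _ hr)))
    | lamBody _ hr => exact .lam hP (iht hr)
  | @app Γ t u A B ht hu iht ihu =>
    obtain ⟨_, hP⟩ := ht.validity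
    obtain ⟨_, _, _, hB⟩ := hP.pi_inv
    have hBu := hB.subst hu
    cases hr with
    | beta A' b _ =>
      obtain ⟨B', _, hP', hb, hc⟩ := ht.lam_inv
      obtain ⟨_, _, hA', _⟩ := hP'.pi_inv
      obtain ⟨hcA, hcB⟩ := hc.pi_inj
      exact .conv (hb.subst (.conv hu hA' hcA.symm)) hBu (hcB.subst u 0)
    | appFun _ hr => exact .app (iht hr) hu
    | appArg _ hr =>
      exact .conv (.app ht (ihu hr)) hBu ((Par.refl B).subst hr.par 0).reds.conv.symm
  | conv _ hB hc iht _ => exact .conv (iht hr) hB hc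

theorem Typed.reds {Γ : Ctx} {t t' T : Tm} (h : Typed Γ t T) (hr : Reds t t') :
    Typed Γ t' T := by
  induction hr with
  | refl => exact h
  | tail _ hr ih => exact ih.red hr

theorem Typed.reds_type {Γ : Ctx} {t T T' : Tm} (h : Typed Γ t T) (hr : Reds T T') :
    Typed Γ t T' := by
  obtain ⟨_, hT⟩ := h.validity
  exact .conv h (hT.reds hr) hr.conv

/-! ### Correctness of bidirectional typing -/

theorem Infer.typed {Γ : Ctx} {t T : Tm} (h : Infer Γ t T) : WfCtx Γ → Typed Γ t T := by
  refine Infer.rec (motive_1 := fun Γ t T _ => WfCtx Γ → Typed Γ t T)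
    (motive_2 := fun Γ t T _ => WfCtx Γ → ∀ i, Typed Γ T (.sort i) → Typed Γ t T)
    (motive_3 := fun Γ t T _ => WfCtx Γ → Typed Γ t T)
    (motive_4 := fun Γ t T _ => WfCtx Γ → Typed Γ t T)
    ?sort ?var ?pi ?lam ?app ?check ?inferSort ?inferPi h
  case sort => exact fun hw => .sort hw
  case var => exact fun hn hw => .var hw hn
  case pi =>
    intro _ _ _ _ _ _ _ ihA ihB hw
    have hA := ihA hw
    exact .pi hA (ihB (.cons hw hA))
  case lam =>
    intro _ _ _ _ _ _ _ ihA iht hw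
    have hA := ihA hw
    have ht := iht (.cons hw hA)
    obtain ⟨_, hB⟩ := ht.validity
    exact .lam (.pi hA hB) ht
  case app =>
    intro _ _ _ _ _ _ _ iht ihu hw
    have ht := iht hw
    obtain ⟨_, hP⟩ := ht.validity
    obtain ⟨_, _, hA, _⟩ := hP.pi_inv
    exact .app ht (ihu hw _ hA)
  case check => exact fun _ hc ih hw _ hT => .conv (ih hw) hT hc
  case inferSort => exact fun _ hr ih hw => (ih hw).reds_type hr
  case inferPi => exact fun _ hr ih hw => (ih hw).reds_type hr

/-- **Correctness of constrained inference.** If `⊢ Γ` and either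
`Γ ⊢ t ▹_□ T` or `Γ ⊢ t ▹_Π T`, then `Γ ⊢ t : T`. -/
theorem constrained_infer_correct {Γ : Ctx} {t T : Tm} (hΓ : WfCtx Γ)
    (h : InferSort Γ t T ∨ InferPi Γ t T) : Typed Γ t T := by
  rcases h with ⟨h, hr⟩ | ⟨h, hr⟩
  · exact (h.typed hΓ).reds_type hr
  · exact (h.typed hΓ).reds_type hr

end CComega
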